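/- arXiv:1010.5205 — 2 statements merged into one kernel-verified Lean document; each statement's English description precedes it below -/
import Mathlib

section
/- Let D̄ be the closed disc in ℂ with centre 0 and radius r > 0, let m be a positive integer, and let R : D̄ → ℂ be continuous and satisfy |R(z) − R(ζ)| < |z^m − ζ^m| for all z, ζ ∈ D̄ with z^m ≠ ζ^m. Define F(z) := z̄^m + R(z), and suppose λ > 1 satisfies |(z^m − ζ^m)·(F(z) − F(ζ))| < λ for all z, ζ ∈ D̄; put B := 4λ(8 r^{2m} λ + 1). Then for every ζ ∈ D̄, the polynomially convex hull of Graph_{D̄}(F) is contained in {(z, w) ∈ D̄ × ℂ : |w − F(ζ)| ≤ (B|z^m − ζ^m|)^{1/3}}. In particular, the fibre of the hull over each ζ ∈ D̄ is the single point (ζ, F(ζ)). -/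
open Complex Metric

noncomputable def pEval (x : ℂ × ℂ) (p : MvPolynomial (Fin 2) ℂ) : ℂ :=
  MvPolynomial.eval ![x.1, x.2] p

/-- The polynomially convex hull of a set in `ℂ²`. -/
noncomputable def polyHull (X : Set (ℂ × ℂ)) : Set (ℂ × ℂ) :=
  {x | ∀ p : MvPolynomial (Fin 2) ℂ, ‖pEval x p‖ ≤ ⨆ y ∈ X, ‖pEval y p‖}

def graphOn (S : Set ℂ) (F : ℂ → ℂ) : Set (ℂ × ℂ) := {q | q.1 ∈ S ∧ q.2 = F q.1}

open Filter Topology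

theorem norm_pEval_le_of_mem_polyHull {X : Set (ℂ × ℂ)} {x : ℂ × ℂ} (hx : x ∈ polyHull X)
    (p : MvPolynomial (Fin 2) ℂ) {C : ℝ} (hC : 0 ≤ C) (hp : ∀ y ∈ X, ‖pEval y p‖ ≤ C) :
    ‖pEval x p‖ ≤ C :=
  (hx p).trans <| Real.iSup_le (fun y => Real.iSup_le (fun hy => hp y hy) hC) hC

theorem subset_polyHull {X : Set (ℂ × ℂ)} (hX : IsCompact X) : X ⊆ polyHull X := by
  intro x hx p
  have hcont : Continuous fun y : ℂ × ℂ => pEval y p := by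
    unfold pEval
    refine (MvPolynomial.continuous_eval p).comp (continuous_pi fun i => ?_)
    fin_cases i
    · exact continuous_fst
    · exact continuous_snd
  obtain ⟨M, hM⟩ := hX.exists_bound_of_continuousOn hcont.continuousOn
  have hM0 : 0 ≤ M := (norm_nonneg _).trans (hM x hx)
  refine le_ciSup_of_le ⟨M, ?_⟩ x (ciSup_pos (f := fun _ => ‖pEval x p‖) hx).ge
  rintro _ ⟨y, rfl⟩
  exact Real.iSup_le (fun hy => hM y hy) hM0

theorem exists_norm_one_sub_mul_le {L ε : ℝ} (hε : 0 < ε) :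
    ∃ δ q : ℝ, 0 ≤ q ∧ q < 1 ∧
      ∀ s : ℂ, 0 ≤ s.re → ‖s‖ ≤ L → ‖1 - (δ : ℂ) * (s + ε)‖ ≤ q := by
  set c : ℝ := ε + L ^ 2 / ε with hc
  have hcε : 0 ≤ c - ε := by rw [hc, add_sub_cancel_left]; positivity
  have hc0 : 0 < c := by linarith
  have hmul : (c - ε) * ε = L ^ 2 := by rw [hc]; field_simp; ring
  refine ⟨c⁻¹, √((c - ε) ^ 2 + L ^ 2) / c, by positivity, ?_, fun s hs hsL => ?_⟩
  · rw [div_lt_one hc0, Real.sqrt_lt' hc0]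
    nlinarith [mul_nonneg hcε hε.le]
  · have hs2 : s.re ^ 2 + s.im ^ 2 ≤ L ^ 2 := by
      have := pow_le_pow_left₀ (norm_nonneg s) hsL 2
      rw [Complex.sq_norm, Complex.normSq_apply] at this
      linarith
    have key : ‖(c : ℂ) - (s + ε)‖ ≤ √((c - ε) ^ 2 + L ^ 2) := by
      apply Real.le_sqrt_of_sq_le
      rw [Complex.sq_norm, Complex.normSq_apply]
      simp only [Complex.sub_re, Complex.add_re, Complex.ofReal_re, Complex.sub_im,
        Complex.add_im, Complex.ofReal_im]
      nlinarith [mul_nonneg hcε hs]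
    have hcC : (c : ℂ) ≠ 0 := by exact_mod_cast hc0.ne'
    have heq : 1 - ((c⁻¹ : ℝ) : ℂ) * (s + ε) = ((c : ℂ) - (s + ε)) / c := by
      push_cast
      field_simp
    rw [heq, norm_div, Complex.norm_real, Real.norm_of_nonneg hc0.le]
    gcongr

/-- If `h` maps `X` into a bounded part of the closed right half-plane, then an estimate
`‖g‖ ≤ C ‖h‖` on `X` persists on the polynomially convex hull of `X`. -/
theorem norm_pEval_le_mul_of_re_nonneg {X : Set (ℂ × ℂ)} {x : ℂ × ℂ} (hx : x ∈ polyHull X)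
    (g h : MvPolynomial (Fin 2) ℂ) {C L : ℝ} (hC : 0 ≤ C)
    (hre : ∀ y ∈ X, 0 ≤ (pEval y h).re) (hL : ∀ y ∈ X, ‖pEval y h‖ ≤ L)
    (hg : ∀ y ∈ X, ‖pEval y g‖ ≤ C * ‖pEval y h‖) :
    ‖pEval x g‖ ≤ C * ‖pEval x h‖ := by
  have shifted : ∀ ε : ℝ, 0 < ε → ‖pEval x g‖ ≤ C * ‖pEval x h + ε‖ := by
    intro ε hε
    obtain ⟨δ, q, hq0, hq1, hq⟩ := exists_norm_one_sub_mul_le (L := L) hε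
    let t : MvPolynomial (Fin 2) ℂ := 1 - MvPolynomial.C (δ : ℂ) * (h + MvPolynomial.C (ε : ℂ))
    have ht : ∀ y, pEval y t = 1 - δ * (pEval y h + ε) := fun y => by simp [t, pEval]
    have htX : ∀ y ∈ X, ‖pEval y t‖ ≤ q := fun y hy => by
      rw [ht]; exact hq _ (hre y hy) (hL y hy)
    have htx : ‖pEval x t‖ ≤ q := norm_pEval_le_of_mem_polyHull hx t hq0 htX
    let S : ℕ → MvPolynomial (Fin 2) ℂ := fun n =>
      g * (MvPolynomial.C (δ : ℂ) * ∑ k ∈ Finset.range n, t ^ k)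
    have hS : ∀ n y, pEval y (S n) * (pEval y h + ε) = pEval y g * (1 - pEval y t ^ n) := by
      intro n y
      have h1 : pEval y (S n) =
          pEval y g * (δ * ∑ k ∈ Finset.range n, pEval y t ^ k) := by
        simp [S, pEval]
      rw [h1, ← mul_neg_geom_sum, ht]
      ring
    have hSX : ∀ n, ∀ y ∈ X, ‖pEval y (S n)‖ ≤ C * (1 + q ^ n) := by
      intro n y hy
      have hpos : 0 < ‖pEval y h + ε‖ := by
        refine lt_of_lt_of_le ?_ (Complex.re_le_norm _)
        simpa using add_pos_of_nonneg_of_pos (hre y hy) hε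
      have hmono : ‖pEval y h‖ ≤ ‖pEval y h + ε‖ := by
        rw [← sq_le_sq₀ (norm_nonneg _) (norm_nonneg _), Complex.sq_norm, Complex.sq_norm,
          Complex.normSq_apply, Complex.normSq_apply]
        simp only [Complex.add_re, Complex.ofReal_re, Complex.add_im, Complex.ofReal_im]
        nlinarith [mul_nonneg (hre y hy) hε.le, sq_nonneg ε]
      refine le_of_mul_le_mul_right ?_ hpos
      rw [← norm_mul, hS, norm_mul]
      have h1 : ‖1 - pEval y t ^ n‖ ≤ 1 + q ^ n := by
        refine (norm_sub_le _ _).trans ?_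
        rw [norm_one, norm_pow]
        gcongr
        exact htX y hy
      calc ‖pEval y g‖ * ‖1 - pEval y t ^ n‖
          ≤ (C * ‖pEval y h + ε‖) * (1 + q ^ n) := by
            gcongr
            exact (hg y hy).trans (by gcongr)
        _ = C * (1 + q ^ n) * ‖pEval y h + ε‖ := by ring
    have hSx : ∀ n, ‖pEval x g * (1 - pEval x t ^ n)‖ ≤ C * (1 + q ^ n) * ‖pEval x h + ε‖ := by
      intro n
      rw [← hS, norm_mul]
      gcongr
      exact norm_pEval_le_of_mem_polyHull hx _ (by positivity) (hSX n)
    have hlim₁ : Tendsto (fun n : ℕ => ‖pEval x g * (1 - pEval x t ^ n)‖) atTop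
        (𝓝 ‖pEval x g * (1 - 0)‖) :=
      (tendsto_const_nhds.mul (tendsto_const_nhds.sub
        (tendsto_pow_atTop_nhds_zero_of_norm_lt_one (htx.trans_lt hq1)))).norm
    have hlim₂ : Tendsto (fun n : ℕ => C * (1 + q ^ n) * ‖pEval x h + ε‖) atTop
        (𝓝 (C * (1 + 0) * ‖pEval x h + ε‖)) :=
      (tendsto_const_nhds.mul (tendsto_const_nhds.add
        (tendsto_pow_atTop_nhds_zero_of_lt_one hq0 hq1))).mul tendsto_const_nhds
    simpa using le_of_tendsto_of_tendsto' hlim₁ hlim₂ hSx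
  have hlim : Tendsto (fun ε : ℝ => C * ‖pEval x h + (ε : ℂ)‖) (𝓝[>] 0)
      (𝓝 (C * ‖pEval x h + ((0 : ℝ) : ℂ)‖)) :=
    (by fun_prop : Continuous fun ε : ℝ => C * ‖pEval x h + (ε : ℂ)‖).continuousAt.mono_left
      nhdsWithin_le_nhds
  simpa using ge_of_tendsto hlim (eventually_mem_nhdsWithin.mono shifted)

/-- A continuous function on a disc whose increments are dominated by those of `z ^ m` off the
fibres of `z ^ m` has its increments dominated everywhere. -/
theorem norm_sub_le_norm_pow_sub_pow {r : ℝ} (hr : 0 < r) {m : ℕ} (hm : 0 < m) {R : ℂ → ℂ}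
    (hRc : ContinuousOn R (closedBall 0 r))
    (hR : ∀ z ∈ closedBall (0 : ℂ) r, ∀ ζ ∈ closedBall (0 : ℂ) r,
      z ^ m ≠ ζ ^ m → ‖R z - R ζ‖ < ‖z ^ m - ζ ^ m‖)
    {z ζ : ℂ} (hz : z ∈ closedBall (0 : ℂ) r) (hζ : ζ ∈ closedBall (0 : ℂ) r) :
    ‖R z - R ζ‖ ≤ ‖z ^ m - ζ ^ m‖ := by
  by_cases hne : z ^ m = ζ ^ m
  swap
  · exact (hR z hz ζ hζ hne).le
  have hfin : {y : ℂ | y ^ m = ζ ^ m}.Finite := by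
    have hp : (Polynomial.X ^ m - Polynomial.C (ζ ^ m) : Polynomial ℂ) ≠ 0 :=
      Polynomial.X_pow_sub_C_ne_zero hm _
    refine (Polynomial.finite_setOfPred_isRoot hp).subset fun y hy => ?_
    simp only [Set.mem_ofPred_eq] at hy
    simp [Polynomial.IsRoot, hy]
  have hball : z ∈ closure (ball (0 : ℂ) r) := by rwa [closure_ball _ hr.ne']
  have hcl : z ∈ closure (ball (0 : ℂ) r \ {y : ℂ | y ^ m = ζ ^ m}) := by
    have hd : Dense ({y : ℂ | y ^ m = ζ ^ m}ᶜ) := hfin.countable.dense_compl ℂ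
    rw [Set.sdiff_eq]
    exact closure_minimal (hd.open_subset_closure_inter isOpen_ball) isClosed_closure hball
  have hsub : ball (0 : ℂ) r \ {y : ℂ | y ^ m = ζ ^ m} ⊆ closedBall 0 r :=
    Set.sdiff_subset.trans ball_subset_closedBall
  have := mem_closure_iff_nhdsWithin_neBot.1 hcl
  have h₁ : Tendsto (fun y => ‖R y - R ζ‖) (𝓝[ball (0 : ℂ) r \ {y : ℂ | y ^ m = ζ ^ m}] z)
      (𝓝 ‖R z - R ζ‖) :=
    (((hRc z hz).mono hsub).sub continuousWithinAt_const).norm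
  have h₂ : Tendsto (fun y => ‖y ^ m - ζ ^ m‖) (𝓝[ball (0 : ℂ) r \ {y : ℂ | y ^ m = ζ ^ m}] z)
      (𝓝 ‖z ^ m - ζ ^ m‖) :=
    ((by fun_prop : Continuous fun y : ℂ => ‖y ^ m - ζ ^ m‖).continuousAt).mono_left
      nhdsWithin_le_nhds
  exact le_of_tendsto_of_tendsto h₁ h₂
    (eventually_mem_nhdsWithin.mono fun y hy => (hR y (hsub hy) ζ hζ hy.2).le)

theorem re_mul_conj_add_nonneg {a b : ℂ} (hab : ‖b‖ ≤ ‖a‖) :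
    0 ≤ (a * ((starRingEnd ℂ) a + b)).re := by
  have h₁ : -(‖a‖ * ‖b‖) ≤ (a * b).re := by
    rw [← norm_mul]
    exact (abs_le.1 (Complex.abs_re_le_norm _)).1
  have h₂ : (a * (starRingEnd ℂ) a).re = ‖a‖ ^ 2 := by
    rw [Complex.mul_conj, Complex.ofReal_re, Complex.sq_norm]
  rw [mul_add, Complex.add_re, h₂]
  nlinarith [mul_le_mul_of_nonneg_left hab (norm_nonneg a)]

/-- The hull estimate (5.4) for `F(z) = z̄^m + R(z)`, with
`B = 4λ(8 r^{2m} λ + 1)`; in particular each fibre of the hull is a single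
point. -/
theorem wermerII_hull_pinch (r lam : ℝ) (hr : 0 < r) (m : ℕ) (hm : 0 < m)
    (R : ℂ → ℂ) (hRc : ContinuousOn R (closedBall 0 r))
    (hR : ∀ z ∈ closedBall (0 : ℂ) r, ∀ ζ ∈ closedBall (0 : ℂ) r,
      z ^ m ≠ ζ ^ m → ‖R z - R ζ‖ < ‖z ^ m - ζ ^ m‖)
    (hlam : 1 < lam)
    (hbd : ∀ z ∈ closedBall (0 : ℂ) r, ∀ ζ ∈ closedBall (0 : ℂ) r,
      ‖(z ^ m - ζ ^ m) *
          (((starRingEnd ℂ) z ^ m + R z) - ((starRingEnd ℂ) ζ ^ m + R ζ))‖ < lam) :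
    ∀ ζ ∈ closedBall (0 : ℂ) r,
      (polyHull (graphOn (closedBall 0 r) (fun z => (starRingEnd ℂ) z ^ m + R z)) ⊆
        {q : ℂ × ℂ | q.1 ∈ closedBall (0 : ℂ) r ∧
          ‖q.2 - ((starRingEnd ℂ) ζ ^ m + R ζ)‖ ≤
            (4 * lam * (8 * r ^ (2 * m) * lam + 1) *
              ‖q.1 ^ m - ζ ^ m‖) ^ ((1 : ℝ) / 3)}) ∧
      polyHull (graphOn (closedBall 0 r) (fun z => (starRingEnd ℂ) z ^ m + R z)) ∩
          {q : ℂ × ℂ | q.1 = ζ} =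
        {(ζ, (starRingEnd ℂ) ζ ^ m + R ζ)} := by
  intro ζ hζ
  set F : ℂ → ℂ := fun z => (starRingEnd ℂ) z ^ m + R z with hF
  set X := graphOn (closedBall 0 r) F with hX
  have hincr : ∀ z ∈ closedBall (0 : ℂ) r, ‖R z - R ζ‖ ≤ ‖z ^ m - ζ ^ m‖ := fun z hz =>
    norm_sub_le_norm_pow_sub_pow hr hm hRc hR hz hζ
  have hFsub : ∀ z, F z - F ζ = (starRingEnd ℂ) (z ^ m - ζ ^ m) + (R z - R ζ) := fun z => by
    simp only [hF, map_sub, map_pow]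
    ring
  have hXc : IsCompact X := by
    have himage : X = (fun z => (z, F z)) '' closedBall (0 : ℂ) r := by
      ext ⟨z, w⟩
      simp only [hX, graphOn, Set.mem_ofPred_eq, Set.mem_image, Prod.mk.injEq]
      constructor
      · rintro ⟨hz, rfl⟩
        exact ⟨z, hz, rfl, rfl⟩
      · rintro ⟨y, hy, rfl, rfl⟩
        exact ⟨hy, rfl⟩
    rw [himage]
    refine (isCompact_closedBall 0 r).image_of_continuousOn (continuousOn_id.prodMk ?_)
    exact (Complex.continuous_conj.pow m).continuousOn.add hRc
  have hlin : ∀ q ∈ polyHull X, q.1 ∈ closedBall (0 : ℂ) r ∧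
      ‖q.2 - F ζ‖ ≤ 2 * ‖q.1 ^ m - ζ ^ m‖ := by
    intro q hq
    constructor
    · have h := norm_pEval_le_of_mem_polyHull hq (MvPolynomial.X 0) hr.le
        (fun y hy => by simpa [pEval] using hy.1)
      simpa [pEval] using h
    · let u : MvPolynomial (Fin 2) ℂ := MvPolynomial.X 1 - MvPolynomial.C (F ζ)
      let v : MvPolynomial (Fin 2) ℂ := MvPolynomial.X 0 ^ m - MvPolynomial.C (ζ ^ m)
      have hu2 : ∀ y, pEval y (u ^ 2) = (y.2 - F ζ) ^ 2 := fun y => by simp [u, pEval]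
      have hvu : ∀ y, pEval y (v * u) = (y.1 ^ m - ζ ^ m) * (y.2 - F ζ) := fun y => by
        simp [u, v, pEval]
      have key := norm_pEval_le_mul_of_re_nonneg hq (u ^ 2) (v * u) (C := 2) (L := lam)
        zero_le_two ?_ ?_ ?_
      · rw [hu2, hvu, norm_pow, norm_mul] at key
        rcases (norm_nonneg (q.2 - F ζ)).eq_or_lt with h0 | h0
        · rw [← h0]
          positivity
        · refine le_of_mul_le_mul_right ?_ h0
          linarith
      · rintro ⟨z, w⟩ ⟨hz, hw⟩
        simp only at hz hw
        rw [hvu, hw, hFsub]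
        exact re_mul_conj_add_nonneg (hincr z hz)
      · rintro ⟨z, w⟩ ⟨hz, hw⟩
        simp only at hz hw
        rw [hvu, hw]
        exact (hbd z hz ζ hζ).le
      · rintro ⟨z, w⟩ ⟨hz, hw⟩
        simp only at hz hw
        rw [hu2, hvu, hw, norm_pow, norm_mul, sq, ← mul_assoc]
        gcongr
        rw [hFsub]
        refine (norm_add_le _ _).trans ?_
        rw [Complex.norm_conj]
        linarith [hincr z hz]
  have hpinch : ∀ q ∈ polyHull X, q.1 ∈ closedBall (0 : ℂ) r ∧
      ‖q.2 - F ζ‖ ≤ (4 * lam * (8 * r ^ (2 * m) * lam + 1) * ‖q.1 ^ m - ζ ^ m‖) ^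
        ((1 : ℝ) / 3) := by
    intro q hq
    obtain ⟨hq1, hq2⟩ := hlin q hq
    refine ⟨hq1, hq2.trans ?_⟩
    set d := ‖q.1 ^ m - ζ ^ m‖ with hd
    have hd0 : 0 ≤ d := norm_nonneg _
    have hdr : d ≤ 2 * r ^ m := by
      refine (norm_sub_le _ _).trans ?_
      rw [norm_pow, norm_pow, two_mul]
      have h1 := pow_le_pow_left₀ (norm_nonneg _) (mem_closedBall_zero_iff.1 hq1) m
      have h2 := pow_le_pow_left₀ (norm_nonneg _) (mem_closedBall_zero_iff.1 hζ) m
      exact add_le_add h1 h2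
    have hd2 : d ^ 2 ≤ 4 * r ^ (2 * m) := by
      calc d ^ 2 ≤ (2 * r ^ m) ^ 2 := by gcongr
        _ = 4 * r ^ (2 * m) := by ring
    have hrm : 0 ≤ r ^ (2 * m) := by positivity
    have hlam2 : (1 : ℝ) ≤ lam * lam := by nlinarith
    have hcoef : 8 * d ^ 2 ≤ 4 * lam * (8 * r ^ (2 * m) * lam + 1) := by
      nlinarith [mul_le_mul_of_nonneg_left hlam2 hrm]
    have hcube : (2 * d) ^ 3 ≤ 4 * lam * (8 * r ^ (2 * m) * lam + 1) * d := by
      nlinarith [mul_le_mul_of_nonneg_right hcoef hd0]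
    calc 2 * d = ((2 * d) ^ 3) ^ ((1 : ℝ) / 3) := by
          rw [← Real.rpow_natCast, ← Real.rpow_mul (by positivity)]
          norm_num
      _ ≤ _ := Real.rpow_le_rpow (by positivity) hcube (by norm_num)
  refine ⟨hpinch, Set.Subset.antisymm ?_ ?_⟩
  · rintro ⟨z, w⟩ ⟨hq, rfl⟩
    have h := (hlin _ hq).2
    simp only [sub_self, norm_zero, mul_zero, norm_le_zero_iff, sub_eq_zero] at h
    simp [h, hF]
  · rintro _ rfl
    exact ⟨subset_polyHull hXc ⟨hζ, rfl⟩, rfl⟩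
end

section
/- Under the hypothesis of the main Hölder theorem — D̄ a closed disc in ℂ with centre 0, F ∈ C^α(D̄) with 0 < α < 1, E ⊂ D̄ nowhere dense, A ∈ 𝒪(D̄) nowhere vanishing, M, K > 0, ν ≥ 1, and for each ζ ∈ D̄ \ E functions G_ζ ∈ 𝒪_ζ(D̄) with |G_ζ(z)| ≤ M|z − ζ| on D̄ and constants C_ζ of modulus 1 with C_ζ·(z − ζ)·(A(z)F(z) − A(ζ)F(ζ) + G_ζ(z)) ∈ W(K, ν) for all z ∈ D̄ — set p := ν(1 + 1/α). Then there exists a constant B ≥ 1, independent of ζ, such that for every ζ ∈ D̄ \ E, the polynomially convex hull of Graph_{D̄}(F) is contained in {(z, w) ∈ D̄ × ℂ : |A(z)w − A(ζ)F(ζ) + G_ζ(z)| ≤ (B|z − ζ|)^{1/(p−1)}}. -/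
open Complex Metric

def HolderOn (F : ℂ → ℂ) (α : ℝ) (S : Set ℂ) : Prop :=
  ∃ c : ℝ, 0 ≤ c ∧ ∀ z ∈ S, ∀ w ∈ S, ‖F z - F w‖ ≤ c * ‖z - w‖ ^ α

/-- Membership in `𝒪(S)`: holomorphic on some open neighbourhood of `S`. -/
def HoloNear (A : ℂ → ℂ) (S : Set ℂ) : Prop :=
  ∃ U : Set ℂ, IsOpen U ∧ S ⊆ U ∧ DifferentiableOn ℂ A U

/-- The wedge `W(K, ν) = {u + iv : u ≥ 0, |v| ≤ K u^{1/ν}}`. -/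
noncomputable def wedge (K ν : ℝ) : Set ℂ :=
  {w : ℂ | 0 ≤ w.re ∧ |w.im| ≤ K * w.re ^ (1 / ν)}

/-- The uniform closure of the polynomials in `C(S, ℂ)`, for `S ⊆ ℂ²`. -/
noncomputable def polyClosure (S : Set (ℂ × ℂ)) [CompactSpace S] : Subalgebra ℂ C(S, ℂ) :=
  (MvPolynomial.aeval (R := ℂ) (![⟨fun x => x.1.1, by fun_prop⟩, ⟨fun x => x.1.2, by fun_prop⟩] :
    Fin 2 → C(S, ℂ))).range.topologicalClosure

lemma aeval_coord_apply {S : Set (ℂ × ℂ)} (p : MvPolynomial (Fin 2) ℂ) (x : S) :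
    (MvPolynomial.aeval (R := ℂ) (![⟨fun x => x.1.1, by fun_prop⟩,
      ⟨fun x => x.1.2, by fun_prop⟩] : Fin 2 → C(S, ℂ)) p) x = pEval x.1 p := by
  induction p using MvPolynomial.induction_on with
  | C a => simp [pEval]
  | add p q hp hq => rw [map_add, ContinuousMap.add_apply, hp, hq]; simp [pEval]
  | mul_X p i hp =>
    rw [map_mul, ContinuousMap.mul_apply, hp]
    fin_cases i <;> simp [pEval]

lemma exists_fst_mem_polyClosure (S : Set (ℂ × ℂ)) [CompactSpace S] :
    ∃ k ∈ polyClosure S, ∀ x, k x = x.1.1 :=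
  ⟨_, Subalgebra.le_topologicalClosure _ ⟨MvPolynomial.X 0, rfl⟩, fun x => by simp⟩

lemma exists_snd_mem_polyClosure (S : Set (ℂ × ℂ)) [CompactSpace S] :
    ∃ k ∈ polyClosure S, ∀ x, k x = x.1.2 :=
  ⟨_, Subalgebra.le_topologicalClosure _ ⟨MvPolynomial.X 1, rfl⟩, fun x => by simp⟩

/-- The maximum principle on the polynomial hull, for uniform limits of polynomials. -/
lemma norm_le_of_mem_polyHull {X S : Set (ℂ × ℂ)} [CompactSpace S] (hXS : X ⊆ S)
    {q : ℂ × ℂ} (hq : q ∈ polyHull X) (hqS : q ∈ S) {g : C(S, ℂ)} (hg : g ∈ polyClosure S)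
    {b : ℝ} (hb : 0 ≤ b) (hgb : ∀ x : S, x.1 ∈ X → ‖g x‖ ≤ b) : ‖g ⟨q, hqS⟩‖ ≤ b := by
  refine le_of_forall_pos_le_add fun ε hε => ?_
  obtain ⟨_, ⟨p, rfl⟩, hp⟩ := Metric.mem_closure_iff.1 hg (ε / 2) (half_pos hε)
  have hd : ∀ x : S, ‖g x - pEval x.1 p‖ ≤ ε / 2 := fun x => by
    have := (ContinuousMap.dist_apply_le_dist x).trans hp.le
    rw [dist_eq_norm] at this
    rwa [← aeval_coord_apply p x]
  have hpq : ‖pEval q p‖ ≤ b + ε / 2 := by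
    refine (hq p).trans (Real.iSup_le (fun y => Real.iSup_le (fun hy => ?_) (by positivity))
      (by positivity))
    have h1 := hgb ⟨y, hXS hy⟩ hy
    have h2 := hd ⟨y, hXS hy⟩
    have h3 := norm_sub_norm_le (pEval y p) (g ⟨y, hXS hy⟩)
    rw [norm_sub_rev] at h3
    linarith
  have h2 := hd ⟨q, hqS⟩
  have h3 := norm_sub_norm_le (g ⟨q, hqS⟩) (pEval q p)
  linarith

lemma exists_comp_mem_polyClosure {S : Set (ℂ × ℂ)} [CompactSpace S] {g : C(S, ℂ)}
    (hg : g ∈ polyClosure S) {f : ℂ → ℂ} {T : ℂ} {ρ R : ℝ} (hρ : 0 ≤ ρ) (hρR : ρ < R)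
    (hgT : ∀ x, ‖g x - T‖ ≤ ρ) (hf : DifferentiableOn ℂ f (ball T R)) :
    ∃ k ∈ polyClosure S, ∀ x, k x = f (g x) := by
  obtain ⟨R₁, h1, h1R⟩ := exists_between hρR
  obtain ⟨R₂, h2, h2R⟩ := exists_between h1
  lift R₁ to NNReal using by linarith
  lift R₂ to NNReal using by linarith
  have hR₁ : (0 : ℝ) < R₁ := by linarith
  have hfs := (hf.mono (closedBall_subset_ball h1R)).hasFPowerSeriesOnBall
    (by exact_mod_cast hR₁)
  have hu := hfs.tendstoUniformlyOn' (r' := R₂) (by exact_mod_cast h2R)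
  set P := cauchyPowerSeries f T R₁
  have hmem : ∀ x, g x ∈ ball T R₂ := fun x => by
    rw [mem_ball, dist_eq_norm]; exact (hgT x).trans_lt h2
  have hcont : Continuous fun x => f (g x) :=
    hf.continuousOn.comp_continuous g.continuous
      fun x => ball_subset_ball (by linarith) (hmem x)
  refine ⟨⟨_, hcont⟩, ?_, fun x => rfl⟩
  let Q : ℕ → C(S, ℂ) := fun n =>
    ∑ i ∈ Finset.range n, P.coeff i • (g - algebraMap ℂ C(S, ℂ) T) ^ i
  have hQ : ∀ n, Q n ∈ polyClosure S := fun n =>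
    Subalgebra.sum_mem _ fun i _ => Subalgebra.smul_mem _
      (Subalgebra.pow_mem _ (Subalgebra.sub_mem _ hg (Subalgebra.algebraMap_mem _ _)) _) _
  refine IsClosed.mem_of_tendsto (Subalgebra.isClosed_topologicalClosure _)
    (f := Q) (b := Filter.atTop) ?_ (Filter.Eventually.of_forall hQ)
  rw [ContinuousMap.tendsto_iff_tendstoUniformly]
  rw [Metric.tendstoUniformly_iff]
  rw [Metric.tendstoUniformlyOn_iff] at hu
  intro ε hε
  filter_upwards [hu ε hε] with n hn x
  have hQx : Q n x = P.partialSum n (g x - T) := by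
    simp [Q, FormalMultilinearSeries.partialSum, mul_comm]
  rw [hQx]
  exact hn (g x) (hmem x)

lemma exists_holo_fst_mem_polyClosure {S : Set (ℂ × ℂ)} [CompactSpace S] {r : ℝ} (hr : 0 ≤ r)
    (hS : ∀ x ∈ S, ‖x.1‖ ≤ r) {f : ℂ → ℂ} (hf : HoloNear f (closedBall 0 r)) :
    ∃ k ∈ polyClosure S, ∀ x, k x = f x.1.1 := by
  obtain ⟨U, hU, hrU, hfU⟩ := hf
  obtain ⟨δ, hδ, hδU⟩ := (isCompact_closedBall (0 : ℂ) r).exists_thickening_subset_open hU hrU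
  rw [thickening_closedBall hδ hr] at hδU
  obtain ⟨z, hz, hzx⟩ := exists_fst_mem_polyClosure S
  obtain ⟨k, hk, hkx⟩ := exists_comp_mem_polyClosure hz hr (show r < δ + r by linarith)
    (T := 0) (fun x => by simpa [hzx] using hS x.1 x.2) (hfU.mono hδU)
  exact ⟨k, hk, fun x => by rw [hkx, hzx]⟩

/-- If `Re s ≥ 0` and `|Y| ≤ c|s|^a` on `X`, then `|Y| ≤ c|s|^a` on the hull: apply the maximum
principle to `Y (s + ε)^{-a}` and let `ε` tend to zero. -/
lemma norm_le_rpow_of_mem_polyHull {X S : Set (ℂ × ℂ)} [CompactSpace S] (hSX : X ⊆ S)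
    {q : ℂ × ℂ} (hq : q ∈ polyHull X) (hqS : q ∈ S) (hS : S ⊆ insert q X)
    {Y s : C(S, ℂ)} (hY : Y ∈ polyClosure S) (hs : s ∈ polyClosure S) {c a : ℝ} (hc : 0 ≤ c)
    (ha : 0 < a) (hre : ∀ x : S, x.1 ∈ X → 0 ≤ (s x).re)
    (hYs : ∀ x : S, x.1 ∈ X → ‖Y x‖ ≤ c * ‖s x‖ ^ a) :
    ‖Y ⟨q, hqS⟩‖ ≤ c * ‖s ⟨q, hqS⟩‖ ^ a := by
  have key : ∀ ε : ℝ, 0 < ε → ‖Y ⟨q, hqS⟩‖ ≤ c * ‖s ⟨q, hqS⟩ + ε‖ ^ a := by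
    intro ε hε
    obtain ⟨T, hT0, hT⟩ : ∃ T : ℝ, 0 < T ∧ ‖s‖ ^ 2 < 2 * T * ε := by
      refine ⟨(‖s‖ ^ 2 + 1) / (2 * ε), by positivity, ?_⟩
      field_simp
      linarith
    set ρ := √(‖s‖ ^ 2 + T ^ 2) with hρ
    have hρT : ρ < T + ε := by
      rw [hρ, Real.sqrt_lt' (by positivity)]
      nlinarith [sq_nonneg ε]
    have hsX : ∀ x : S, x.1 ∈ X → ‖s x - T‖ ≤ ρ := fun x hx => by
      refine Real.le_sqrt_of_sq_le ?_
      have h1 : ‖s x‖ ^ 2 ≤ ‖s‖ ^ 2 := by gcongr; exact s.norm_coe_le_norm x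
      have h2 := hre x hx
      rw [Complex.sq_norm, Complex.normSq_apply] at h1 ⊢
      simp only [sub_re, ofReal_re, sub_im, ofReal_im, sub_zero]
      nlinarith [mul_nonneg hT0.le h2]
    have hsT : ∀ x : S, ‖s x - T‖ ≤ ρ := by
      rintro ⟨x, hx⟩
      rcases hS hx with rfl | hx'
      · exact norm_le_of_mem_polyHull hSX hq hx (g := s - algebraMap ℂ C(S, ℂ) T)
          (Subalgebra.sub_mem _ hs (Subalgebra.algebraMap_mem _ _)) (Real.sqrt_nonneg _)
          (fun x hx => by simpa using hsX x hx)
      · exact hsX _ hx'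
    have hslit : ∀ w ∈ ball (T : ℂ) (T + ε), w + ε ∈ slitPlane := fun w hw => by
      left
      rw [mem_ball, dist_eq_norm] at hw
      have := (abs_le.1 ((Complex.abs_re_le_norm (w - T)).trans hw.le)).1
      have h2 := (abs_lt.1 ((Complex.abs_re_le_norm (w - T)).trans_lt hw)).1
      simp at h2 ⊢
      linarith
    obtain ⟨k, hk, hkx⟩ := exists_comp_mem_polyClosure hs (Real.sqrt_nonneg _) hρT hsT
      (f := fun w => (w + ε) ^ ((-a : ℝ) : ℂ))
      (DifferentiableOn.cpow_const (by fun_prop) hslit)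
    have hne : ∀ x, 0 < ‖s x + ε‖ := fun x => norm_pos_iff.2 <| slitPlane_ne_zero <|
      hslit _ <| by rw [mem_ball, dist_eq_norm]; exact (hsT x).trans_lt hρT
    have hnorm : ∀ x, ‖(Y * k) x‖ = ‖Y x‖ / ‖s x + ε‖ ^ a := fun x => by
      rw [ContinuousMap.mul_apply, norm_mul, hkx, Complex.norm_cpow_real,
        Real.rpow_neg (norm_nonneg _), div_eq_mul_inv]
    have := norm_le_of_mem_polyHull hSX hq hqS (Subalgebra.mul_mem _ hY hk) hc
      fun x hx => by
        rw [hnorm, div_le_iff₀ (Real.rpow_pos_of_pos (hne x) _)]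
        refine (hYs x hx).trans ?_
        gcongr
        have h2 := hre x hx
        rw [← sq_le_sq₀ (norm_nonneg _) (norm_nonneg _), Complex.sq_norm, Complex.sq_norm,
          Complex.normSq_apply, Complex.normSq_apply]
        simp only [add_re, ofReal_re, add_im, ofReal_im, add_zero]
        nlinarith
    rwa [hnorm, div_le_iff₀ (Real.rpow_pos_of_pos (hne _) _)] at this
  have hlim : Filter.Tendsto (fun ε : ℝ => c * ‖s ⟨q, hqS⟩ + ε‖ ^ a) (nhdsWithin 0 (Set.Ioi 0))
      (nhds (c * ‖s ⟨q, hqS⟩‖ ^ a)) := by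
    have : Continuous fun ε : ℝ => c * ‖s ⟨q, hqS⟩ + ε‖ ^ a :=
      continuous_const.mul (Continuous.rpow_const (by fun_prop) fun _ => Or.inr ha.le)
    simpa using this.continuousWithinAt (s := Set.Ioi 0) (x := 0) |>.tendsto
  exact ge_of_tendsto hlim (Filter.eventually_of_mem self_mem_nhdsWithin key)

lemma le_mul_rpow_iff {x y c α : ℝ} (hx : 0 ≤ x) (hy : 0 ≤ y) (hc : 0 ≤ c) (hα : 0 < α) :
    y ≤ c * x ^ α ↔ y ≤ c ^ (1 / (1 + α)) * (x * y) ^ (α / (1 + α)) := by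
  have h1 : (0 : ℝ) < 1 + α := by linarith
  rw [← Real.rpow_le_rpow_iff (y := c ^ _ * _) hy (by positivity) h1, Real.mul_rpow (by positivity) (by positivity),
    ← Real.rpow_mul hc, ← Real.rpow_mul (by positivity), div_mul_cancel₀ _ h1.ne',
    div_mul_cancel₀ _ h1.ne', Real.rpow_one, Real.mul_rpow hx hy]
  rcases hy.eq_or_lt with rfl | hy
  · simp only [Real.zero_rpow h1.ne', Real.zero_rpow hα.ne', mul_zero, le_refl, iff_true]
    positivity
  · rw [Real.rpow_add hy, Real.rpow_one, ← mul_assoc]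
    exact (mul_le_mul_iff_left₀ (by positivity)).symm

lemma HolderOn.continuousOn {F : ℂ → ℂ} {α : ℝ} {S : Set ℂ} (hF : HolderOn F α S) (hα : 0 < α) :
    ContinuousOn F S := by
  obtain ⟨c, hc, h⟩ := hF
  intro z hz
  rw [ContinuousWithinAt, tendsto_iff_norm_sub_tendsto_zero]
  have hlim : Filter.Tendsto (fun w => c * ‖w - z‖ ^ α) (nhdsWithin z S) (nhds 0) := by
    have : Continuous fun w => c * ‖w - z‖ ^ α :=
      continuous_const.mul (Continuous.rpow_const (by fun_prop) fun _ => Or.inr hα.le)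
    simpa [Real.zero_rpow hα.ne'] using this.continuousWithinAt (s := S) (x := z) |>.tendsto
  exact squeeze_zero' (Filter.Eventually.of_forall fun _ => norm_nonneg _)
    (Filter.eventually_of_mem self_mem_nhdsWithin fun w hw => h w hw z hz) hlim

lemma isCompact_graphOn {F : ℂ → ℂ} {S : Set ℂ} (hS : IsCompact S) (hF : ContinuousOn F S) :
    IsCompact (graphOn S F) := by
  convert hS.image_of_continuousOn (continuousOn_id.prodMk hF) using 1
  ext ⟨z, w⟩
  simp only [graphOn, Set.mem_ofPred_eq, Set.mem_image, id, Prod.mk.injEq]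
  constructor
  · rintro ⟨h, rfl⟩; exact ⟨z, h, rfl, rfl⟩
  · rintro ⟨z, h, rfl, rfl⟩; exact ⟨h, rfl⟩

lemma norm_fst_le_of_mem_polyHull {F : ℂ → ℂ} {r : ℝ} (hr : 0 ≤ r) {q : ℂ × ℂ}
    (hq : q ∈ polyHull (graphOn (closedBall 0 r) F)) : ‖q.1‖ ≤ r := by
  have := hq (MvPolynomial.X 0)
  simp only [pEval, MvPolynomial.eval_X, Matrix.cons_val_zero] at this
  refine this.trans (Real.iSup_le (fun y => Real.iSup_le (fun hy => ?_) hr) hr)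
  simpa using hy.1

/-- The difference `A F - A(ζ) F(ζ) + g` is uniformly `O(|z - ζ|^α)`. -/
lemma exists_norm_le_rpow {r α M : ℝ} (hr : 0 < r) (hα0 : 0 < α) (hα1 : α < 1) (hM : 0 < M)
    {F A : ℂ → ℂ} (hF : HolderOn F α (closedBall 0 r)) (hA : HoloNear A (closedBall 0 r)) :
    ∃ c : ℝ, 0 ≤ c ∧ ∀ z ∈ closedBall (0 : ℂ) r, ∀ ζ ∈ closedBall (0 : ℂ) r, ∀ g : ℂ,
      ‖g‖ ≤ M * ‖z - ζ‖ → ‖A z * F z - A ζ * F ζ + g‖ ≤ c * ‖z - ζ‖ ^ α := by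
  have hcpt := isCompact_closedBall (0 : ℂ) r
  obtain ⟨CF, hCF⟩ := hcpt.exists_bound_of_continuousOn (hF.continuousOn hα0)
  obtain ⟨U, hU, hrU, hAU⟩ := hA
  obtain ⟨CA, hCA⟩ := hcpt.exists_bound_of_continuousOn (hAU.continuousOn.mono hrU)
  obtain ⟨L, hL⟩ := (((hAU.contDiffOn (n := 1) hU).mono hrU).restrict_scalars
    ℝ).exists_lipschitzOnWith one_ne_zero (convex_closedBall _ _) hcpt
  obtain ⟨c, hc, hF⟩ := hF
  have hCF0 : 0 ≤ CF := (norm_nonneg _).trans (hCF 0 (by simp [hr.le]))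
  have hCA0 : 0 ≤ CA := (norm_nonneg _).trans (hCA 0 (by simp [hr.le]))
  refine ⟨CA * c + (L * CF + M) * (2 * r) ^ (1 - α), by positivity, fun z hz ζ hζ g hg => ?_⟩
  have hd : ‖z - ζ‖ ≤ 2 * r := by
    have := norm_sub_le z ζ
    simp only [mem_closedBall, dist_zero_right] at hz hζ
    linarith
  have hlin : ‖z - ζ‖ ≤ (2 * r) ^ (1 - α) * ‖z - ζ‖ ^ α := by
    calc ‖z - ζ‖ = ‖z - ζ‖ ^ (1 - α) * ‖z - ζ‖ ^ α := by
          rw [← Real.rpow_add_of_nonneg (norm_nonneg _) (by linarith) hα0.le]; simp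
      _ ≤ _ := by gcongr
  have hLz : ‖A z - A ζ‖ ≤ L * ‖z - ζ‖ := by
    simpa [dist_eq_norm] using hL.dist_le_mul z hz ζ hζ
  calc ‖A z * F z - A ζ * F ζ + g‖
      = ‖A z * (F z - F ζ) + (A z - A ζ) * F ζ + g‖ := by ring_nf
    _ ≤ ‖A z‖ * ‖F z - F ζ‖ + ‖A z - A ζ‖ * ‖F ζ‖ + ‖g‖ := by
        rw [← norm_mul, ← norm_mul]; exact norm_add₃_le
    _ ≤ CA * (c * ‖z - ζ‖ ^ α) + (L * ‖z - ζ‖) * CF + M * ‖z - ζ‖ := by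
        gcongr
        exacts [hCA z hz, hF z hz ζ hζ, hCF ζ hζ]
    _ = CA * c * ‖z - ζ‖ ^ α + (L * CF + M) * ‖z - ζ‖ := by ring
    _ ≤ CA * c * ‖z - ζ‖ ^ α + (L * CF + M) * ((2 * r) ^ (1 - α) * ‖z - ζ‖ ^ α) := by gcongr
    _ = _ := by ring

/-- On the hull, `A w - A(ζ) F(ζ) + g` obeys the same Hölder bound as on the graph. -/
lemma norm_le_of_mem_polyHull_graphOn {r α c : ℝ} (hr : 0 ≤ r) (hα0 : 0 < α) (hc : 0 ≤ c)
    {F A g : ℂ → ℂ} {ζ C b : ℂ} (hF : ContinuousOn F (closedBall 0 r))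
    (hA : HoloNear A (closedBall 0 r)) (hg : HoloNear g (closedBall 0 r)) (hC : ‖C‖ = 1)
    (hre : ∀ z ∈ closedBall (0 : ℂ) r, 0 ≤ (C * (z - ζ) * (A z * F z - b + g z)).re)
    (hbd : ∀ z ∈ closedBall (0 : ℂ) r, ‖A z * F z - b + g z‖ ≤ c * ‖z - ζ‖ ^ α) {q : ℂ × ℂ}
    (hq : q ∈ polyHull (graphOn (closedBall 0 r) F)) :
    ‖A q.1 * q.2 - b + g q.1‖ ≤ c * ‖q.1 - ζ‖ ^ α := by
  have hcpt := isCompact_graphOn (isCompact_closedBall (0 : ℂ) r) hF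
  set S := insert q (graphOn (closedBall 0 r) F) with hSdef
  have : CompactSpace S := isCompact_iff_compactSpace.1 (hcpt.insert q)
  have hS : ∀ x ∈ S, ‖x.1‖ ≤ r := by
    rintro x (rfl | hx)
    · exact norm_fst_le_of_mem_polyHull hr hq
    · simpa using hx.1
  have hqS : q ∈ S := Set.mem_insert _ _
  obtain ⟨Z, hZ, hZx⟩ := exists_fst_mem_polyClosure S
  obtain ⟨W, hW, hWx⟩ := exists_snd_mem_polyClosure S
  obtain ⟨A', hA', hAx⟩ := exists_holo_fst_mem_polyClosure hr hS hA
  obtain ⟨g', hg', hgx⟩ := exists_holo_fst_mem_polyClosure hr hS hg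
  let Y : C(S, ℂ) := A' * W - algebraMap ℂ _ b + g'
  have hY : Y ∈ polyClosure S := Subalgebra.add_mem _ (Subalgebra.sub_mem _
    (Subalgebra.mul_mem _ hA' hW) (Subalgebra.algebraMap_mem _ _)) hg'
  let s : C(S, ℂ) := algebraMap ℂ _ C * (Z - algebraMap ℂ _ ζ) * Y
  have hs : s ∈ polyClosure S := Subalgebra.mul_mem _ (Subalgebra.mul_mem _
    (Subalgebra.algebraMap_mem _ _) (Subalgebra.sub_mem _ hZ (Subalgebra.algebraMap_mem _ _))) hY
  have hYx : ∀ x : S, Y x = A x.1.1 * x.1.2 - b + g x.1.1 := fun x => by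
    simp [Y, hAx, hWx, hgx]
  have hsx : ∀ x : S, s x = C * (x.1.1 - ζ) * (A x.1.1 * x.1.2 - b + g x.1.1) := fun x => by
    rw [← hYx]; simp [s, hZx]
  have hsn : ∀ x : S, ‖s x‖ = ‖x.1.1 - ζ‖ * ‖Y x‖ := fun x => by
    rw [hsx, norm_mul, norm_mul, hC, one_mul, hYx]
  have := norm_le_rpow_of_mem_polyHull (Set.subset_insert _ _) hq hqS subset_rfl hY hs
    (c := c ^ (1 / (1 + α))) (a := α / (1 + α)) (by positivity) (by positivity)
    (fun x hx => by rw [hsx, hx.2]; exact hre _ hx.1)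
    (fun x hx => by
      rw [hsn, ← le_mul_rpow_iff (norm_nonneg _) (norm_nonneg _) hc hα0, hYx, hx.2]
      exact hbd _ hx.1)
  rwa [hsn, ← le_mul_rpow_iff (norm_nonneg _) (norm_nonneg _) hc hα0, hYx] at this

/-- The hull estimate (3.1): under the hypotheses of Theorem 1.1, with
`p := ν(1 + 1/α)`, there is a uniform constant `B ≥ 1` such that the hull of the
graph of `F` lies in
`{(z,w) : |A(z)w − A(ζ)F(ζ) + G_ζ(z)| ≤ (B|z − ζ|)^{1/(p−1)}}` for all
`ζ ∈ D̄ \ E`. -/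
theorem holder_hull_estimate (r α M K ν : ℝ) (hr : 0 < r)
    (hα0 : 0 < α) (hα1 : α < 1)
    (F A : ℂ → ℂ) (E : Set ℂ) (G : ℂ → ℂ → ℂ) (C : ℂ → ℂ)
    (hF : HolderOn F α (closedBall 0 r))
    (hE : E ⊆ closedBall 0 r) (hEnd : IsNowhereDense E)
    (hA : HoloNear A (closedBall 0 r))
    (hA0 : ∀ z ∈ closedBall (0 : ℂ) r, A z ≠ 0)
    (hM : 0 < M) (hK : 0 < K) (hν : 1 ≤ ν)
    (hG : ∀ ζ ∈ closedBall (0 : ℂ) r \ E,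
      HoloNear (G ζ) (closedBall 0 r) ∧ G ζ ζ = 0 ∧
        ∀ z ∈ closedBall (0 : ℂ) r, ‖G ζ z‖ ≤ M * ‖z - ζ‖)
    (hC : ∀ ζ ∈ closedBall (0 : ℂ) r \ E,
      ‖C ζ‖ = 1 ∧
        ∀ z ∈ closedBall (0 : ℂ) r,
          C ζ * (z - ζ) * (A z * F z - A ζ * F ζ + G ζ z) ∈ wedge K ν) :
    ∃ B : ℝ, 1 ≤ B ∧
      ∀ ζ ∈ closedBall (0 : ℂ) r \ E,
        polyHull (graphOn (closedBall 0 r) F) ⊆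
          {q : ℂ × ℂ | q.1 ∈ closedBall (0 : ℂ) r ∧
            ‖A q.1 * q.2 - A ζ * F ζ + G ζ q.1‖ ≤
              (B * ‖q.1 - ζ‖) ^ (1 / (ν * (1 + 1 / α) - 1))} := by
  obtain ⟨c, hc, hbd⟩ := exists_norm_le_rpow hr hα0 hα1 hM hF hA
  set β := 1 / (ν * (1 + 1 / α) - 1) with hβ
  have hp : 1 / α ≤ ν * (1 + 1 / α) - 1 := by
    have : 0 ≤ (ν - 1) * (1 + 1 / α) := mul_nonneg (by linarith) (by positivity)
    linarith
  have hβ0 : 0 < β := one_div_pos.2 ((one_div_pos.2 hα0).trans_le hp)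
  have hβα : β ≤ α := by
    simpa only [one_div_one_div] using one_div_le_one_div_of_le (one_div_pos.2 hα0) hp
  refine ⟨max 1 ((c * (2 * r) ^ (α - β)) ^ (1 / β)), le_max_left _ _, fun ζ hζ q hq => ?_⟩
  have hq1 : ‖q.1‖ ≤ r := norm_fst_le_of_mem_polyHull hr.le hq
  refine ⟨by simpa using hq1, ?_⟩
  obtain ⟨hGh, -, hGb⟩ := hG ζ hζ
  obtain ⟨hC1, hCW⟩ := hC ζ hζ
  have hd : ‖q.1 - ζ‖ ≤ 2 * r := by
    have h1 := norm_sub_le q.1 ζ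
    have h2 : ‖ζ‖ ≤ r := by simpa using hζ.1
    linarith
  calc ‖A q.1 * q.2 - A ζ * F ζ + G ζ q.1‖ ≤ c * ‖q.1 - ζ‖ ^ α :=
        norm_le_of_mem_polyHull_graphOn hr.le hα0 hc (hF.continuousOn hα0) hA hGh hC1
          (fun z hz => (hCW z hz).1) (fun z hz => hbd z hz ζ hζ.1 _ (hGb z hz)) hq
    _ = c * (‖q.1 - ζ‖ ^ (α - β) * ‖q.1 - ζ‖ ^ β) := by
        rw [← Real.rpow_add_of_nonneg (norm_nonneg _) (by linarith) hβ0.le, sub_add_cancel]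
    _ ≤ c * ((2 * r) ^ (α - β) * ‖q.1 - ζ‖ ^ β) := by gcongr
    _ = ((c * (2 * r) ^ (α - β)) ^ (1 / β) * ‖q.1 - ζ‖) ^ β := by
        rw [Real.mul_rpow (by positivity) (norm_nonneg _), ← Real.rpow_mul (by positivity),
          one_div_mul_cancel hβ0.ne', Real.rpow_one, mul_assoc]
    _ ≤ _ := by gcongr; exact le_max_right _ _
end
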